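/- Let α ∈ (0, 1) ∪ (1, ∞) and let X, Y be positive semidefinite complex n×n matrices with X ≠ 0. Then, as ξ → 0 from above, the quantity (1/(α−1)) · log( Tr[((Y + ξI)^((1−α)/(2α)) · X · (Y + ξI)^((1−α)/(2α)))^α] / Tr[X] ) converges in ℝ ∪ {+∞} to D̃_α(X‖Y); in particular, it converges to the finite value D̃_α(X‖Y) when X is not orthogonal to Y and (the kernel of Y is contained in the kernel of X, or α < 1), and it tends to +∞ otherwise. -/

import Mathlib

open Matrix
open scoped Kronecker Classical ComplexOrder

/-- Real power of a matrix via functional calculus on the eigenvalues of a Hermitian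
matrix, with the convention that eigenvalue `0` is mapped to `0` (powers are taken on
the support). Non-Hermitian matrices are mapped to `0`. -/
noncomputable def matPow {n : Type*} [Fintype n] [DecidableEq n]
    (A : Matrix n n ℂ) (t : ℝ) : Matrix n n ℂ :=
  if hA : A.IsHermitian then
    (hA.eigenvectorUnitary : Matrix n n ℂ) *
      Matrix.diagonal (fun i =>
        ((if hA.eigenvalues i = 0 then (0 : ℝ) else hA.eigenvalues i ^ t : ℝ) : ℂ)) *
      (star (hA.eigenvectorUnitary : Matrix n n ℂ))
  else 0

/-- `dominates σ ρ` (written `σ ≫ ρ` in the paper): the kernel of `σ` is contained in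
the kernel of `ρ`. -/
def dominates {n : Type*} [Fintype n] (σ ρ : Matrix n n ℂ) : Prop :=
  ∀ v : n → ℂ, σ.mulVec v = 0 → ρ.mulVec v = 0

/-- The sandwiched Rényi divergence of order `α`, with values in `ℝ ∪ {+∞}` (as a
subset of `EReal`), logarithms base 2. It is `+∞` unless `ρ` is not orthogonal to `σ`
(i.e. `Tr[ρσ] ≠ 0`) and (`σ ≫ ρ` or `α < 1`). -/
noncomputable def Dtilde {n : Type*} [Fintype n] [DecidableEq n]
    (α : ℝ) (ρ σ : Matrix n n ℂ) : EReal :=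
  if (ρ * σ).trace ≠ 0 ∧ (dominates σ ρ ∨ α < 1) then
    (((α - 1)⁻¹ * Real.logb 2
        ((matPow (matPow σ ((1 - α) / (2 * α)) * ρ * matPow σ ((1 - α) / (2 * α))) α).trace.re
          / ρ.trace.re) : ℝ) : EReal)
  else ⊤

section MatPow

variable {n : Type*} [Fintype n] [DecidableEq n]

/-- The real power function with `0 ^ t = 0` for every `t`. -/
noncomputable def suppPow (t x : ℝ) : ℝ := if x = 0 then 0 else x ^ t

lemma suppPow_of_pos_exponent {t : ℝ} (ht : 0 < t) (x : ℝ) : suppPow t x = x ^ t := by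
  unfold suppPow
  split_ifs with h
  · rw [h, Real.zero_rpow ht.ne']
  · rfl

lemma suppPow_eq_zero_iff {t x : ℝ} (hx : 0 ≤ x) : suppPow t x = 0 ↔ x = 0 := by
  unfold suppPow
  split_ifs with h
  · simp [h]
  · simp [h, Real.rpow_eq_zero_iff_of_nonneg hx]

lemma matPow_eq_cfc {A : Matrix n n ℂ} (hA : A.IsHermitian) (t : ℝ) :
    matPow A t = cfc (suppPow t) A := by
  rw [hA.cfc_eq, matPow, dif_pos hA, IsHermitian.cfc, Unitary.conjStarAlgAut_apply]
  congr!

lemma matPow_add_smul_one {A : Matrix n n ℂ} (hA : A.IsHermitian) (ξ t : ℝ) :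
    matPow (A + (ξ : ℂ) • 1) t =
      (hA.eigenvectorUnitary : Matrix n n ℂ) *
        diagonal (fun i => (suppPow t (hA.eigenvalues i + ξ) : ℂ)) *
        star (hA.eigenvectorUnitary : Matrix n n ℂ) := by
  have hsa : IsSelfAdjoint A := hA
  have hfin : (spectrum ℝ A).Finite := by
    rw [hA.spectrum_real_eq_range_eigenvalues]
    exact Set.finite_range _
  have hadd : cfc (fun x : ℝ => x + ξ) A = A + (ξ : ℂ) • 1 := by
    rw [cfc_add_const ξ (fun x => x) A, cfc_id' ℝ A, Algebra.algebraMap_eq_smul_one]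
    simp
  have hherm : (A + (ξ : ℂ) • 1).IsHermitian := by
    rw [← hadd]
    exact cfc_predicate _ A
  rw [matPow_eq_cfc hherm, ← hadd,
    ← cfc_comp' (suppPow t) (fun x => x + ξ) A ((hfin.image _).continuousOn _),
    hA.cfc_eq, IsHermitian.cfc, Unitary.conjStarAlgAut_apply]
  rfl

lemma matPow_eq {A : Matrix n n ℂ} (hA : A.IsHermitian) (t : ℝ) :
    matPow A t =
      (hA.eigenvectorUnitary : Matrix n n ℂ) *
        diagonal (fun i => (suppPow t (hA.eigenvalues i) : ℂ)) *
        star (hA.eigenvectorUnitary : Matrix n n ℂ) := by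
  simpa using matPow_add_smul_one hA 0 t

lemma trace_unitary_conj (U : unitaryGroup n ℂ) (M : Matrix n n ℂ) :
    ((U : Matrix n n ℂ) * M * star (U : Matrix n n ℂ)).trace = M.trace := by
  rw [trace_mul_cycle, Unitary.coe_star_mul_self, one_mul]

lemma re_trace_matPow {A : Matrix n n ℂ} (hA : A.IsHermitian) (t : ℝ) :
    (matPow A t).trace.re = ∑ i, suppPow t (hA.eigenvalues i) := by
  rw [matPow_eq hA, trace_unitary_conj, trace_diagonal]
  simp

lemma re_trace_eq_sum {A : Matrix n n ℂ} (hA : A.IsHermitian) :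
    A.trace.re = ∑ i, hA.eigenvalues i := by
  rw [hA.trace_eq_sum_eigenvalues]
  simp

lemma re_trace_matPow_pos {A : Matrix n n ℂ} (hA : A.PosSemidef) (hA0 : A ≠ 0) (t : ℝ) :
    0 < (matPow A t).trace.re := by
  have hnn : ∀ i, 0 ≤ suppPow t (hA.1.eigenvalues i) := fun i => by
    unfold suppPow
    split_ifs
    · exact le_rfl
    · exact Real.rpow_nonneg (hA.eigenvalues_nonneg i) _
  obtain ⟨i, hi⟩ : ∃ i, hA.1.eigenvalues i ≠ 0 := by
    by_contra! h
    exact hA0 (hA.1.eigenvalues_eq_zero_iff.1 (funext h))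
  rw [re_trace_matPow hA.1]
  exact Finset.sum_pos' (fun i _ => hnn i) ⟨i, Finset.mem_univ i, lt_of_le_of_ne (hnn i)
    (Ne.symm (mt (suppPow_eq_zero_iff (hA.eigenvalues_nonneg i)).1 hi))⟩

lemma matPow_zero {t : ℝ} : matPow (0 : Matrix n n ℂ) t = 0 := by
  have h : (isHermitian_zero : (0 : Matrix n n ℂ).IsHermitian).eigenvalues = 0 :=
    (IsHermitian.eigenvalues_eq_zero_iff _).2 rfl
  rw [matPow_eq isHermitian_zero, h]
  simp [suppPow]

lemma re_trace_sub_card_le_matPow {A : Matrix n n ℂ} (hA : A.PosSemidef) {t : ℝ} (ht : 1 ≤ t) :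
    A.trace.re - Fintype.card n ≤ (matPow A t).trace.re := by
  rw [re_trace_matPow hA.1, re_trace_eq_sum hA.1, sub_le_iff_le_add]
  calc ∑ i, hA.1.eigenvalues i
      ≤ ∑ i, (suppPow t (hA.1.eigenvalues i) + 1) := by
        refine Finset.sum_le_sum fun i _ => ?_
        rw [suppPow_of_pos_exponent (by linarith)]
        rcases le_total 1 (hA.1.eigenvalues i) with h | h
        · linarith [Real.self_le_rpow_of_one_le h ht]
        · linarith [Real.rpow_nonneg (hA.eigenvalues_nonneg i) t]
    _ = _ := by simp [Finset.sum_add_distrib]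

open scoped Matrix.Norms.L2Operator in
lemma continuousOn_matPow {t : ℝ} (ht : 0 < t) :
    ContinuousOn (fun A : Matrix n n ℂ => matPow A t) {A | A.IsHermitian} := by
  have hf : Continuous (suppPow t) := by
    rw [funext (suppPow_of_pos_exponent ht)]
    exact Real.continuous_rpow_const ht.le
  have h : ContinuousOn (fun A : Matrix n n ℂ => cfc (suppPow t) A) {A | IsSelfAdjoint A} :=
    ContinuousOn.cfc_of_mem_nhdsSet (s := Set.univ) (suppPow t) Filter.univ_mem continuousOn_id
      (fun _ h => h) hf.continuousOn
  exact h.congr fun A hA => matPow_eq_cfc hA t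

lemma tendsto_re_trace_matPow {ι : Type*} {l : Filter ι} {Z : ι → Matrix n n ℂ}
    {Z₀ : Matrix n n ℂ} {t : ℝ} (ht : 0 < t) (hZ : ∀ i, (Z i).IsHermitian)
    (hZ₀ : Z₀.IsHermitian) (h : Filter.Tendsto Z l (nhds Z₀)) :
    Filter.Tendsto (fun i => (matPow (Z i) t).trace.re) l (nhds (matPow Z₀ t).trace.re) := by
  have h1 : Filter.Tendsto (fun i => matPow (Z i) t) l (nhds (matPow Z₀ t)) :=
    (continuousOn_matPow ht Z₀ hZ₀).tendsto.comp
      (tendsto_nhdsWithin_iff.2 ⟨h, Filter.Eventually.of_forall hZ⟩)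
  have h2 : Continuous fun A : Matrix n n ℂ => A.trace.re :=
    Complex.continuous_re.comp continuous_id.matrix_trace
  exact (h2.tendsto _).comp h1

/-- The conjugate by `U` of `M` rescaled on both sides by the real diagonal matrix of `g`. -/
noncomputable def conjScale (U : unitaryGroup n ℂ) (M : Matrix n n ℂ) (g : n → ℝ) :
    Matrix n n ℂ :=
  (U : Matrix n n ℂ) * (of fun i j => (g i : ℂ) * M i j * (g j : ℂ)) * star (U : Matrix n n ℂ)

lemma diagonal_mul_mul_diagonal (M : Matrix n n ℂ) (g : n → ℝ) :
    diagonal (fun i => (g i : ℂ)) * M * diagonal (fun i => (g i : ℂ)) =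
      of fun i j => (g i : ℂ) * M i j * (g j : ℂ) := by
  ext i j
  simp [mul_diagonal, diagonal_mul]

lemma conj_mul_mul_conj (U : unitaryGroup n ℂ) (X : Matrix n n ℂ) (g : n → ℝ) :
    ((U : Matrix n n ℂ) * diagonal (fun i => (g i : ℂ)) * star (U : Matrix n n ℂ)) * X *
      ((U : Matrix n n ℂ) * diagonal (fun i => (g i : ℂ)) * star (U : Matrix n n ℂ)) =
      conjScale U (star (U : Matrix n n ℂ) * X * U) g := by
  rw [conjScale, ← diagonal_mul_mul_diagonal]
  simp only [Matrix.mul_assoc]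

lemma posSemidef_conjScale (U : unitaryGroup n ℂ) {M : Matrix n n ℂ} (hM : M.PosSemidef)
    (g : n → ℝ) : (conjScale U M g).PosSemidef := by
  have hd : (diagonal (fun i => (g i : ℂ)))ᴴ = diagonal (fun i => (g i : ℂ)) := by
    rw [diagonal_conjTranspose]
    congr 1
    ext i
    simp
  have h := hM.mul_mul_conjTranspose_same (diagonal (fun i => (g i : ℂ)))
  rw [hd, diagonal_mul_mul_diagonal] at h
  exact h.mul_mul_conjTranspose_same (U : Matrix n n ℂ)

lemma re_trace_conjScale (U : unitaryGroup n ℂ) (M : Matrix n n ℂ) (g : n → ℝ) :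
    (conjScale U M g).trace.re = ∑ i, g i * g i * (M i i).re := by
  rw [conjScale, trace_unitary_conj, trace, Complex.re_sum]
  refine Finset.sum_congr rfl fun i _ => ?_
  simp only [diag_apply, of_apply, Complex.mul_re, Complex.mul_im, Complex.ofReal_re,
    Complex.ofReal_im]
  ring

lemma conjScale_eq_zero_iff (U : unitaryGroup n ℂ) (M : Matrix n n ℂ) (g : n → ℝ) :
    conjScale U M g = 0 ↔ ∀ i j, g i = 0 ∨ M i j = 0 ∨ g j = 0 := by
  have h : conjScale U M g = 0 ↔ (of fun i j => (g i : ℂ) * M i j * (g j : ℂ)) = 0 := by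
    refine ⟨fun h => ?_, fun h => by rw [conjScale, h]; simp⟩
    have h2 : star (U : Matrix n n ℂ) * conjScale U M g * U = 0 := by rw [h]; simp
    rw [conjScale] at h2
    simpa [Matrix.mul_assoc, ← Matrix.mul_assoc (star (U : Matrix n n ℂ)) (U : Matrix n n ℂ)]
      using h2
  rw [h, ← Matrix.ext_iff]
  simp [or_assoc]

lemma tendsto_conjScale (U : unitaryGroup n ℂ) (M : Matrix n n ℂ) {ι : Type*} {l : Filter ι}
    {g : ι → n → ℝ} {g₀ : n → ℝ}
    (h : ∀ i j, M i j ≠ 0 → Filter.Tendsto (fun a => g a i) l (nhds (g₀ i)) ∧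
      Filter.Tendsto (fun a => g a j) l (nhds (g₀ j))) :
    Filter.Tendsto (fun a => conjScale U M (g a)) l (nhds (conjScale U M g₀)) := by
  have h1 : Filter.Tendsto (fun a => (of fun i j => (g a i : ℂ) * M i j * (g a j : ℂ)) :
      ι → Matrix n n ℂ) l (nhds (of fun i j => (g₀ i : ℂ) * M i j * (g₀ j : ℂ))) := by
    refine tendsto_pi_nhds.2 fun i => tendsto_pi_nhds.2 fun j => ?_
    simp only [of_apply]
    by_cases hM : M i j = 0
    · simpa [hM] using tendsto_const_nhds
    · obtain ⟨hi, hj⟩ := h i j hM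
      exact ((Complex.continuous_ofReal.tendsto _ |>.comp hi).mul_const _).mul
        (Complex.continuous_ofReal.tendsto _ |>.comp hj)
  have h2 : Continuous fun W : Matrix n n ℂ =>
      (U : Matrix n n ℂ) * W * star (U : Matrix n n ℂ) := by fun_prop
  exact (h2.tendsto _).comp h1

lemma Matrix.PosSemidef.apply_eq_zero_of_diag {M : Matrix n n ℂ} (hM : M.PosSemidef) {j : n}
    (h : M j j = 0) (i : n) : M i j = 0 := by
  have h1 := (hM.dotProduct_mulVec_zero_iff (Pi.single j 1)).1 (by simp [h])
  simpa using congrFun h1 i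

lemma trace_mul_eq_sum_eigenvalues {X Y : Matrix n n ℂ} (hY : Y.IsHermitian) :
    (X * Y).trace = ∑ i, (star (hY.eigenvectorUnitary : Matrix n n ℂ) * X *
      hY.eigenvectorUnitary) i i * (hY.eigenvalues i : ℂ) := by
  conv_lhs => rw [hY.spectral_theorem, Unitary.conjStarAlgAut_apply]
  rw [← Matrix.mul_assoc, ← Matrix.mul_assoc, trace_mul_comm, ← Matrix.mul_assoc,
    ← Matrix.mul_assoc, trace]
  simp [mul_diagonal]

lemma trace_mul_eq_zero_iff_eigenvalues {X Y : Matrix n n ℂ} (hX : X.PosSemidef)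
    (hY : Y.PosSemidef) :
    (X * Y).trace = 0 ↔ ∀ i, (star (hY.1.eigenvectorUnitary : Matrix n n ℂ) * X *
      hY.1.eigenvectorUnitary) i i = 0 ∨ hY.1.eigenvalues i = 0 := by
  have hM := hX.conjTranspose_mul_mul_same (hY.1.eigenvectorUnitary : Matrix n n ℂ)
  rw [trace_mul_eq_sum_eigenvalues hY.1, Finset.sum_eq_zero_iff_of_nonneg]
  · simp
  · exact fun i _ => mul_nonneg hM.diag_nonneg (by exact_mod_cast hY.eigenvalues_nonneg i)

lemma dominates_iff_eigenvalues {X Y : Matrix n n ℂ} (hY : Y.IsHermitian) :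
    dominates Y X ↔ ∀ j, hY.eigenvalues j = 0 → ∀ i,
      (star (hY.eigenvectorUnitary : Matrix n n ℂ) * X * hY.eigenvectorUnitary) i j = 0 := by
  set U : Matrix n n ℂ := (hY.eigenvectorUnitary : Matrix n n ℂ)
  have hUU : U * star U = 1 := Unitary.coe_mul_star_self _
  have hUU' : star U * U = 1 := Unitary.coe_star_mul_self _
  have hspec : Y = U * diagonal (fun i => (hY.eigenvalues i : ℂ)) * star U := by
    conv_lhs => rw [hY.spectral_theorem, Unitary.conjStarAlgAut_apply]
    rfl
  have hYv : ∀ v, Y *ᵥ v = U *ᵥ (fun i => (hY.eigenvalues i : ℂ) * (star U *ᵥ v) i) := by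
    intro v
    conv_lhs => rw [hspec]
    rw [← mulVec_mulVec, ← mulVec_mulVec]
    congr 1
    ext i
    rw [mulVec_diagonal]
  constructor
  · intro h j hj i
    have h0 : Y *ᵥ (U *ᵥ Pi.single j 1) = 0 := by
      rw [hYv, mulVec_mulVec, hUU', one_mulVec]
      convert mulVec_zero U using 2
      ext i
      by_cases hij : i = j
      · simp [hij, hj]
      · simp [hij]
    have h1 : (star U * X * U) *ᵥ Pi.single j 1 = 0 := by
      rw [← mulVec_mulVec, ← mulVec_mulVec, h _ h0, mulVec_zero]
    simpa using congrFun h1 i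
  · intro h v hv
    have h0 : ∀ i, (hY.eigenvalues i : ℂ) * (star U *ᵥ v) i = 0 := by
      intro i
      have h1 : star U *ᵥ (Y *ᵥ v) = 0 := by rw [hv, mulVec_zero]
      rw [hYv, mulVec_mulVec, hUU', one_mulVec] at h1
      exact congrFun h1 i
    have h1 : (star U * X * U) *ᵥ (star U *ᵥ v) = 0 := by
      ext i
      refine Finset.sum_eq_zero fun j _ => ?_
      rcases mul_eq_zero.1 (h0 j) with hj | hj
      · simp only [h j (by exact_mod_cast hj) i, zero_mul]
      · simp only [hj, mul_zero]
    have h2 : U *ᵥ ((star U * X * U) *ᵥ (star U *ᵥ v)) = X *ᵥ v := by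
      rw [mulVec_mulVec, mulVec_mulVec]
      congr 1
      rw [← Matrix.mul_assoc, ← Matrix.mul_assoc, hUU, Matrix.one_mul, Matrix.mul_assoc, hUU,
        Matrix.mul_one]
    rw [← h2, h1, mulVec_zero]

lemma tendsto_suppPow_add {t x : ℝ} (h : x ≠ 0 ∨ 0 < t) :
    Filter.Tendsto (fun ξ : ℝ => suppPow t (x + ξ)) (nhdsWithin 0 (Set.Ioi 0))
      (nhds (suppPow t x)) := by
  have hadd : Filter.Tendsto (fun ξ : ℝ => x + ξ) (nhdsWithin 0 (Set.Ioi 0)) (nhds x) := by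
    refine Filter.Tendsto.mono_left ?_ nhdsWithin_le_nhds
    simpa using (continuous_const.add continuous_id).tendsto (f := fun ξ : ℝ => x + ξ) 0
  refine Filter.Tendsto.comp (g := suppPow t) ?_ hadd
  rcases h with h | h
  · have hev : suppPow t =ᶠ[nhds x] fun z => z ^ t := by
      filter_upwards [isOpen_ne.mem_nhds h] with z hz
      exact if_neg hz
    rw [show suppPow t x = x ^ t from if_neg h]
    exact (Real.continuousAt_rpow_const x t (Or.inl h)).congr' hev.symm
  · rw [funext (suppPow_of_pos_exponent h)]
    exact (Real.continuous_rpow_const h.le).tendsto x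

lemma tendsto_suppPow_atTop {t : ℝ} (ht : t < 0) :
    Filter.Tendsto (suppPow t) (nhdsWithin 0 (Set.Ioi 0)) Filter.atTop := by
  refine (tendsto_rpow_neg_nhdsGT_zero ht).congr' ?_
  filter_upwards [self_mem_nhdsWithin] with x hx
  exact (if_neg (ne_of_gt hx)).symm

end MatPow

/-- the regularized expression with `Y + ξI` converges, as `ξ → 0⁺`, to
`D̃_α(X‖Y)` in `ℝ ∪ {+∞}` (finite when `X ⊥̸ Y` and (`ker Y ⊆ ker X` or `α < 1`),
and `+∞` otherwise, by definition of `D̃_α`). -/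
theorem stmt19 {n : ℕ} {α : ℝ} (hα : α ∈ Set.Ioo (0 : ℝ) 1 ∪ Set.Ioi 1)
    {X Y : Matrix (Fin n) (Fin n) ℂ}
    (hX : X.PosSemidef) (hY : Y.PosSemidef) (hX0 : X ≠ 0) :
    Filter.Tendsto (fun ξ : ℝ =>
        (((α - 1)⁻¹ * Real.logb 2
          ((matPow (matPow (Y + (ξ : ℂ) • 1) ((1 - α) / (2 * α)) * X
              * matPow (Y + (ξ : ℂ) • 1) ((1 - α) / (2 * α))) α).trace.re
            / X.trace.re) : ℝ) : EReal))
      (nhdsWithin 0 (Set.Ioi 0)) (nhds (Dtilde α X Y)) := by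
  have hα0 : 0 < α := by
    rcases hα with h | h
    · exact h.1
    · exact one_pos.trans h
  have hα1 : α ≠ 1 := by
    rcases hα with h | h
    · exact h.2.ne
    · exact ne_of_gt h
  set p : ℝ := (1 - α) / (2 * α) with hp
  set U := hY.1.eigenvectorUnitary
  set y := hY.1.eigenvalues
  set M : Matrix (Fin n) (Fin n) ℂ := star (U : Matrix (Fin n) (Fin n) ℂ) * X * U
  have hM : M.PosSemidef := hX.conjTranspose_mul_mul_same (U : Matrix (Fin n) (Fin n) ℂ)
  have hy0 : ∀ i, 0 ≤ y i := hY.eigenvalues_nonneg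
  have hMtr : M.trace = X.trace := by
    have h := trace_unitary_conj (star U) X
    simpa using h
  have hM0 : M ≠ 0 := fun h => hX0 (hX.trace_eq_zero_iff.1 (by rw [← hMtr, h, trace_zero]))
  have hXtr : 0 < X.trace.re := by
    have h0 := Complex.nonneg_iff.1 hX.trace_nonneg
    refine lt_of_le_of_ne h0.1 fun h => hX0 (hX.trace_eq_zero_iff.1 (Complex.ext h.symm h0.2.symm))
  let Z : ℝ → Matrix (Fin n) (Fin n) ℂ := fun ξ => conjScale U M fun i => suppPow p (y i + ξ)
  let Z₀ : Matrix (Fin n) (Fin n) ℂ := conjScale U M fun i => suppPow p (y i)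
  have hZeq : ∀ ξ : ℝ, matPow (Y + (ξ : ℂ) • 1) p * X * matPow (Y + (ξ : ℂ) • 1) p = Z ξ :=
    fun ξ => by rw [matPow_add_smul_one hY.1, conj_mul_mul_conj]
  have hZ₀eq : matPow Y p * X * matPow Y p = Z₀ := by rw [matPow_eq hY.1, conj_mul_mul_conj]
  have hZpsd : ∀ ξ, (Z ξ).PosSemidef := fun ξ => posSemidef_conjScale U hM _
  have hZ₀psd : Z₀.PosSemidef := posSemidef_conjScale U hM _
  have hdom : dominates Y X ↔ ∀ j, y j = 0 → ∀ i, M i j = 0 := dominates_iff_eigenvalues hY.1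
  have htr : (X * Y).trace = 0 ↔ ∀ i, M i i = 0 ∨ y i = 0 :=
    trace_mul_eq_zero_iff_eigenvalues hX hY
  simp only [hZeq]
  clear_value M y U
  have hZlim : dominates Y X ∨ α < 1 → Filter.Tendsto (fun ξ => (matPow (Z ξ) α).trace.re)
      (nhdsWithin 0 (Set.Ioi 0)) (nhds (matPow Z₀ α).trace.re) := by
    intro h
    refine tendsto_re_trace_matPow hα0 (fun ξ => (hZpsd ξ).1) hZ₀psd.1
      (tendsto_conjScale U M fun i j hij => ?_)
    suffices h' : (y i ≠ 0 ∨ 0 < p) ∧ (y j ≠ 0 ∨ 0 < p) from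
      ⟨tendsto_suppPow_add h'.1, tendsto_suppPow_add h'.2⟩
    rcases h with h | h
    · rw [hdom] at h
      refine ⟨Or.inl fun hi => hij ?_, Or.inl fun hj => hij (h j hj i)⟩
      rw [← hM.1.apply i j, h i hi j, star_zero]
    · have hp0 : 0 < p := div_pos (by linarith) (by linarith)
      exact ⟨Or.inr hp0, Or.inr hp0⟩
  by_cases hcond : (X * Y).trace ≠ 0 ∧ (dominates Y X ∨ α < 1)
  · have hZ₀0 : Z₀ ≠ 0 := fun h => hcond.1 <| htr.2 fun i => by
      have h' := (conjScale_eq_zero_iff U M _).1 h i i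
      rw [suppPow_eq_zero_iff (hy0 i)] at h'
      exact h'.elim Or.inr id
    have hpos := re_trace_matPow_pos hZ₀psd hZ₀0 α
    rw [Dtilde, if_pos hcond, ← hp, hZ₀eq, EReal.tendsto_coe]
    refine Filter.Tendsto.const_mul _ ?_
    exact (Real.continuousAt_logb (div_pos hpos hXtr).ne').tendsto.comp
      ((hZlim hcond.2).div_const _)
  rw [Dtilde, if_neg hcond, EReal.tendsto_coe_nhds_top_iff]
  by_cases hd : dominates Y X ∨ α < 1
  · have htr0 : (X * Y).trace = 0 := not_not.1 fun h => hcond ⟨h, hd⟩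
    rw [htr] at htr0
    have hlt : α < 1 := by
      refine hd.resolve_left fun h => hM0 (hM.trace_eq_zero_iff.1 ?_)
      rw [hdom] at h
      exact Finset.sum_eq_zero fun i _ => (htr0 i).elim id fun hi => h i hi i
    have hZ₀0 : Z₀ = 0 := (conjScale_eq_zero_iff U M _).2 fun i j => by
      rw [suppPow_eq_zero_iff (hy0 i), suppPow_eq_zero_iff (hy0 j)]
      rcases htr0 j with h | h
      · exact Or.inr (Or.inl (hM.apply_eq_zero_of_diag h i))
      · exact Or.inr (Or.inr h)
    have hlim := hZlim hd
    rw [hZ₀0, matPow_zero, trace_zero, Complex.zero_re] at hlim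
    have hpos : ∀ᶠ ξ in nhdsWithin (0 : ℝ) (Set.Ioi 0),
        (matPow (Z ξ) α).trace.re / X.trace.re ∈ Set.Ioi (0 : ℝ) := by
      filter_upwards [self_mem_nhdsWithin] with ξ hξ
      refine div_pos (re_trace_matPow_pos (hZpsd ξ) (fun h => hM0 ?_) α) hXtr
      have hne : ∀ i, suppPow p (y i + ξ) ≠ 0 := fun i =>
        mt (suppPow_eq_zero_iff (add_nonneg (hy0 i) (le_of_lt hξ))).1
          (add_pos_of_nonneg_of_pos (hy0 i) hξ).ne'
      ext i j
      simpa [hne] using (conjScale_eq_zero_iff U M _).1 h i j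
    refine Filter.Tendsto.const_mul_atBot_of_neg (inv_lt_zero.2 (by linarith)) ?_
    refine (Real.tendsto_logb_nhdsGT_zero one_lt_two).comp (tendsto_nhdsWithin_iff.2 ⟨?_, hpos⟩)
    simpa using hlim.div_const X.trace.re
  · push Not at hd
    have hgt : 1 < α := lt_of_le_of_ne hd.2 hα1.symm
    have hp0 : p < 0 := div_neg_of_neg_of_pos (by linarith) (by linarith)
    obtain ⟨k, hk, hkk⟩ : ∃ k, y k = 0 ∧ M k k ≠ 0 := by
      by_contra! h
      exact hd.1 (hdom.2 fun j hj i => hM.apply_eq_zero_of_diag (h j hj) i)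
    have hdiag : ∀ i, 0 ≤ (M i i).re := fun i => (Complex.nonneg_iff.1 hM.diag_nonneg).1
    have hkpos : 0 < (M k k).re := by
      have h0 := Complex.nonneg_iff.1 (hM.diag_nonneg (i := k))
      exact lt_of_le_of_ne h0.1 fun h => hkk (Complex.ext h.symm h0.2.symm)
    have hbound : ∀ ξ, suppPow p ξ * suppPow p ξ * (M k k).re - (Fintype.card (Fin n) : ℝ) ≤
        (matPow (Z ξ) α).trace.re := fun ξ => by
      refine le_trans (sub_le_sub_right ?_ _) (re_trace_sub_card_le_matPow (hZpsd ξ) hgt.le)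
      rw [re_trace_conjScale]
      refine le_trans (by rw [hk, zero_add]) (Finset.single_le_sum
        (f := fun i => suppPow p (y i + ξ) * suppPow p (y i + ξ) * (M i i).re)
        (fun i _ => mul_nonneg (mul_self_nonneg _) (hdiag i)) (Finset.mem_univ k))
    have hg := tendsto_suppPow_atTop hp0
    have hlim : Filter.Tendsto (fun ξ => (matPow (Z ξ) α).trace.re)
        (nhdsWithin 0 (Set.Ioi 0)) Filter.atTop :=
      Filter.tendsto_atTop_mono hbound (Filter.tendsto_atTop_add_const_right _ _
        ((hg.atTop_mul_atTop₀ hg).atTop_mul_const hkpos))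
    exact ((Real.tendsto_logb_atTop one_lt_two).comp (hlim.atTop_div_const hXtr)).const_mul_atTop
      (inv_pos.2 (by linarith))
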